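/- arXiv:1504.01713 — 5 statements merged into one kernel-verified Lean document; each statement's English description precedes it below -/
import Mathlib

section
/- Let H be a square matrix with complex entries. If H is semiconvergent, then for every positive integer ℓ the matrix ∑_{i=0}^{ℓ−1} H^i is nonsingular (invertible). -/
/-- A square matrix `H` is *semiconvergent* if `lim_{i → ∞} H ^ i` exists. -/
def Semiconvergent {n : ℕ} (H : Matrix (Fin n) (Fin n) ℂ) : Prop :=
  ∃ L : Matrix (Fin n) (Fin n) ℂ, Filter.Tendsto (fun i : ℕ => H ^ i) Filter.atTop (nhds L)

open Filter Topology in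
/-- A periodic vector of a semiconvergent matrix is a fixed vector. -/
theorem Semiconvergent.mulVec_eq_of_pow_mulVec_eq {n : ℕ} {H : Matrix (Fin n) (Fin n) ℂ}
    (hH : Semiconvergent H) {ℓ : ℕ} (hℓ : 0 < ℓ) {v : Fin n → ℂ}
    (hv : (H ^ ℓ).mulVec v = v) : H.mulVec v = v := by
  obtain ⟨L, hL⟩ := hH
  have hlim : Tendsto (fun i : ℕ => (H ^ i).mulVec v) atTop (𝓝 (L.mulVec v)) :=
    ((continuous_id.matrix_mulVec continuous_const).tendsto L).comp hL
  have hper (k : ℕ) : (H ^ (ℓ * k)).mulVec v = v := by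
    induction k with
    | zero => simp
    | succ k ih => rw [Nat.mul_succ, pow_add, ← Matrix.mulVec_mulVec, hv, ih]
  have hsub : Tendsto (fun k : ℕ => ℓ * k) atTop atTop := tendsto_id.const_mul_atTop' hℓ
  have hfix : L.mulVec v = v := by
    refine tendsto_nhds_unique (hlim.comp hsub) ?_
    simp [Function.comp_def, hper]
  have hshift : L.mulVec v = H.mulVec v := by
    refine tendsto_nhds_unique (hlim.comp ((tendsto_add_atTop_nat 1).comp hsub)) ?_
    simp [Function.comp_def, pow_succ', ← Matrix.mulVec_mulVec, hper]
  exact hshift.symm.trans hfix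

/-- If `H` is semiconvergent, then `∑_{i=0}^{ℓ-1} H ^ i` is nonsingular for all `ℓ ∈ ℕ`, `ℓ ≥ 1`. -/
theorem isUnit_geom_sum_of_semiconvergent {n : ℕ} (H : Matrix (Fin n) (Fin n) ℂ)
    (hH : Semiconvergent H) :
    ∀ ℓ : ℕ, 0 < ℓ → IsUnit (∑ i ∈ Finset.range ℓ, H ^ i) := by
  intro ℓ hℓ
  rw [← Matrix.mulVec_injective_iff_isUnit,
    ← Matrix.coe_mulVecLin, injective_iff_map_eq_zero]
  intro v hv
  rw [Matrix.mulVecLin_apply] at hv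
  have hper : (H ^ ℓ).mulVec v = v := by
    rw [← sub_eq_zero]
    calc (H ^ ℓ).mulVec v - v = (H ^ ℓ - 1).mulVec v := by
          rw [Matrix.sub_mulVec, Matrix.one_mulVec]
      _ = 0 := by rw [← mul_geom_sum, ← Matrix.mulVec_mulVec, hv, Matrix.mulVec_zero]
  have hfix := hH.mulVec_eq_of_pow_mulVec_eq hℓ hper
  have hpow (i : ℕ) : (H ^ i).mulVec v = v := by
    induction i with
    | zero => simp
    | succ i ih => rw [pow_succ, ← Matrix.mulVec_mulVec, hfix, ih]
  simpa [Matrix.sum_mulVec, hpow, hℓ.ne', -nsmul_eq_mul] using hv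
end

section
/- Let H be a square matrix with complex entries. If H is semiconvergent, then for every positive integer ℓ the matrix I − H^ℓ is a GP matrix, i.e., ker(I − H^ℓ) ∩ range(I − H^ℓ) = {0}. -/
/-- If `H` is semiconvergent, then `I - H ^ ℓ` is a GP matrix for all `ℓ ≥ 1`, i.e.
`ker (I - H ^ ℓ) ∩ range (I - H ^ ℓ) = {0}`. -/
theorem isGP_one_sub_pow_of_semiconvergent {n : ℕ} (H : Matrix (Fin n) (Fin n) ℂ)
    (hH : Semiconvergent H) :
    ∀ ℓ : ℕ, 0 < ℓ →
      LinearMap.ker ((1 - H ^ ℓ).mulVecLin) ⊓ LinearMap.range ((1 - H ^ ℓ).mulVecLin) = ⊥ := by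
  rintro ℓ hℓ
  obtain ⟨L, hL⟩ := hH
  rw [Submodule.eq_bot_iff]
  rintro v ⟨hker, w, rfl⟩
  set G := H ^ ℓ with hG
  have hlim : Filter.Tendsto (fun i : ℕ => (G ^ i).mulVec w) Filter.atTop (nhds (L.mulVec w)) := by
    have hpow : Filter.Tendsto (fun i : ℕ => G ^ i) Filter.atTop (nhds L) := by
      simp only [hG, ← pow_mul]
      exact hL.comp (Filter.tendsto_id.const_mul_atTop' hℓ)
    have hcont : Continuous fun M : Matrix (Fin n) (Fin n) ℂ => M.mulVec w :=
      continuous_id.matrix_mulVec continuous_const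
    exact (hcont.tendsto L).comp hpow
  simp only [SetLike.mem_coe, LinearMap.mem_ker, Matrix.mulVecLin_apply] at hker ⊢
  have hfix : G.mulVec ((1 - G).mulVec w) = (1 - G).mulVec w := by
    rw [Matrix.sub_mulVec 1 G ((1 - G).mulVec w), Matrix.one_mulVec, sub_eq_zero] at hker
    exact hker.symm
  have hfix_pow (i : ℕ) : (G ^ i).mulVec ((1 - G).mulVec w) = (1 - G).mulVec w := by
    induction i with
    | zero => simp
    | succ i ih => rw [pow_succ, ← Matrix.mulVec_mulVec, hfix, ih]
  have hdiff (i : ℕ) : (G ^ i).mulVec w - (G ^ (i + 1)).mulVec w = (1 - G).mulVec w := by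
    rw [← hfix_pow i, Matrix.mulVec_mulVec, ← Matrix.sub_mulVec, mul_sub, mul_one, pow_succ]
  have hzero := hlim.sub (hlim.comp (Filter.tendsto_add_atTop_nat 1))
  simp only [Function.comp_apply, hdiff, sub_self] at hzero
  exact tendsto_nhds_unique tendsto_const_nhds hzero
end

section
/- Let A, M, N be n × n complex matrices with A = M − N and M invertible, let H = M⁻¹N, and for a positive integer ℓ let C^{(ℓ)} = (∑_{i=0}^{ℓ−1} H^i) M⁻¹. If H is semiconvergent, then C^{(ℓ)} is invertible and the preconditioned matrix C^{(ℓ)}A is a GP matrix, i.e., ker(C^{(ℓ)}A) ∩ range(C^{(ℓ)}A) = {0}. -/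
open Filter Topology in
/-- The orbit of a vector under the powers of a semiconvergent matrix converges. -/
theorem Semiconvergent.exists_tendsto_mulVec {n : ℕ} {H : Matrix (Fin n) (Fin n) ℂ}
    (h : Semiconvergent H) (v : Fin n → ℂ) :
    ∃ w, Tendsto (fun i : ℕ => (H ^ i).mulVec v) atTop (𝓝 w) := by
  obtain ⟨L, hL⟩ := h
  have hc : Continuous fun B : Matrix (Fin n) (Fin n) ℂ => B.mulVec v := by fun_prop
  exact ⟨L.mulVec v, (hc.tendsto L).comp hL⟩

theorem Semiconvergent.pow {n : ℕ} {H : Matrix (Fin n) (Fin n) ℂ} (h : Semiconvergent H)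
    {k : ℕ} (hk : 0 < k) : Semiconvergent (H ^ k) := by
  obtain ⟨L, hL⟩ := h
  refine ⟨L, ?_⟩
  simp only [← pow_mul]
  exact hL.comp (Filter.tendsto_id.const_mul_atTop' hk)

theorem Matrix.pow_mulVec_eq_self {n : ℕ} {K : Matrix (Fin n) (Fin n) ℂ} {v : Fin n → ℂ}
    (hv : K.mulVec v = v) (i : ℕ) : (K ^ i).mulVec v = v := by
  induction i with
  | zero => simp
  | succ i ih => rw [pow_succ, ← Matrix.mulVec_mulVec, hv, ih]

/-- A periodic vector of a semiconvergent matrix is a fixed vector. -/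
theorem Semiconvergent.mulVec_eq_self_of_pow {n : ℕ} {H : Matrix (Fin n) (Fin n) ℂ}
    (h : Semiconvergent H) {k : ℕ} (hk : 0 < k) {v : Fin n → ℂ}
    (hv : (H ^ k).mulVec v = v) : H.mulVec v = v := by
  obtain ⟨w, hw⟩ := h.exists_tendsto_mulVec v
  have hsub : Filter.Tendsto (fun i : ℕ => k * i) Filter.atTop Filter.atTop :=
    Filter.tendsto_id.const_mul_atTop' hk
  have h₀ := hw.comp hsub
  have h₁ := hw.comp ((Filter.tendsto_add_atTop_nat 1).comp hsub)
  simp only [Function.comp_def, pow_succ', ← Matrix.mulVec_mulVec, pow_mul,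
    Matrix.pow_mulVec_eq_self hv] at h₀ h₁
  exact (tendsto_nhds_unique tendsto_const_nhds h₁).trans
    (tendsto_nhds_unique tendsto_const_nhds h₀).symm

/-- The partial geometric sums of a semiconvergent matrix are invertible. -/
theorem Semiconvergent.isUnit_geom_sum {n : ℕ} {H : Matrix (Fin n) (Fin n) ℂ}
    (h : Semiconvergent H) {k : ℕ} (hk : 0 < k) : IsUnit (∑ i ∈ Finset.range k, H ^ i) := by
  rw [← Matrix.mulVec_injective_iff_isUnit]
  refine (injective_iff_map_eq_zero (Matrix.mulVecLin (∑ i ∈ Finset.range k, H ^ i))).2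
    fun v hv => ?_
  rw [Matrix.mulVecLin_apply] at hv
  have hpow : (H ^ k).mulVec v = v := by
    have := congrArg (fun B => B.mulVec v) (mul_neg_geom_sum H k)
    simp only [← Matrix.mulVec_mulVec, hv, Matrix.mulVec_zero, Matrix.sub_mulVec,
      Matrix.one_mulVec] at this
    exact (sub_eq_zero.1 this.symm).symm
  have hfix := h.mulVec_eq_self_of_pow hk hpow
  simp only [Matrix.sum_mulVec, Matrix.pow_mulVec_eq_self hfix, Finset.sum_const,
    Finset.card_range] at hv
  exact (smul_eq_zero.1 hv).resolve_left hk.ne'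

/-- If `K` is semiconvergent then `1 - K` is a GP matrix. -/
theorem Semiconvergent.ker_inf_range_one_sub {n : ℕ} {K : Matrix (Fin n) (Fin n) ℂ}
    (h : Semiconvergent K) :
    LinearMap.ker ((1 - K).mulVecLin) ⊓ LinearMap.range ((1 - K).mulVecLin) = ⊥ := by
  rw [eq_bot_iff]
  rintro x ⟨hx, y, hy⟩
  simp only [SetLike.mem_coe, LinearMap.mem_ker, Matrix.mulVecLin_apply, Matrix.sub_mulVec,
    Matrix.one_mulVec, sub_eq_zero] at hx hy
  obtain ⟨w, hw⟩ := h.exists_tendsto_mulVec y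
  have hlim := hw.sub (hw.comp (Filter.tendsto_add_atTop_nat 1))
  have hconst (i : ℕ) : (K ^ i).mulVec y - (K ^ (i + 1)).mulVec y = x := by
    rw [pow_succ, ← Matrix.mulVec_mulVec, ← Matrix.mulVec_sub, hy,
      Matrix.pow_mulVec_eq_self hx.symm]
  simp only [Function.comp_def, hconst, sub_self] at hlim
  exact tendsto_nhds_unique tendsto_const_nhds hlim

/-- If `A = M - N` with `M` invertible, `H = M⁻¹ N` is semiconvergent, and
`C = (∑_{i=0}^{ℓ-1} H ^ i) M⁻¹`, then `C` is invertible and `C * A` is a GP matrix. -/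
theorem preconditioned_isUnit_and_isGP {n : ℕ} (A M N H C : Matrix (Fin n) (Fin n) ℂ)
    (hM : IsUnit M) (hA : A = M - N) (hH : H = M⁻¹ * N) (hsemi : Semiconvergent H)
    (ℓ : ℕ) (hℓ : 0 < ℓ) (hC : C = (∑ i ∈ Finset.range ℓ, H ^ i) * M⁻¹) :
    IsUnit C ∧
      LinearMap.ker ((C * A).mulVecLin) ⊓ LinearMap.range ((C * A).mulVecLin) = ⊥ := by
  have hS := hsemi.isUnit_geom_sum hℓ
  have hdet : IsUnit M.det := (Matrix.isUnit_iff_isUnit_det M).1 hM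
  have hCA : C * A = 1 - H ^ ℓ := by
    rw [hC, hA, mul_assoc, mul_sub, Matrix.nonsing_inv_mul M hdet, ← hH, geom_sum_mul_neg]
  refine ⟨?_, ?_⟩
  · rw [hC]
    exact hS.mul (Matrix.isUnit_nonsing_inv_iff.2 hM)
  · rw [hCA]
    exact (hsemi.pow hℓ).ker_inf_range_one_sub
end

section
/- Let A, M, N be n × n complex matrices with A = M − N and M invertible, let H = M⁻¹N, and for a positive integer ℓ let C^{(ℓ)} = (∑_{i=0}^{ℓ−1} H^i) M⁻¹. Then the spectrum of the preconditioned matrix A C^{(ℓ)} equals {1 − μ^ℓ : μ is an eigenvalue of H}. -/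
open Polynomial in
theorem spectrum.one_sub_pow {𝕜 R : Type*} [Field 𝕜] [IsAlgClosed 𝕜] [Ring R] [Algebra 𝕜 R]
    (a : R) {k : ℕ} (hk : 0 < k) :
    spectrum 𝕜 (1 - a ^ k) = (fun μ : 𝕜 => 1 - μ ^ k) '' spectrum 𝕜 a := by
  have hdeg : 0 < degree (1 - X ^ k : 𝕜[X]) := by
    rw [← neg_sub, degree_neg, ← C_1, degree_X_pow_sub_C hk]
    exact_mod_cast hk
  simpa using spectrum.map_polynomial_aeval_of_degree_pos a (1 - X ^ k : 𝕜[X]) hdeg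

/-- If `A = M - N` with `M` invertible, `H = M⁻¹ N`, and
`C = (∑_{i=0}^{ℓ-1} H ^ i) M⁻¹`, then the spectrum of the preconditioned matrix
`A * C` is `{1 - μ ^ ℓ : μ ∈ σ(H)}`. -/
theorem spectrum_preconditioned_matrix {n : ℕ} (A M N H C : Matrix (Fin n) (Fin n) ℂ)
    (hM : IsUnit M) (hA : A = M - N) (hH : H = M⁻¹ * N)
    (ℓ : ℕ) (hℓ : 0 < ℓ) (hC : C = (∑ i ∈ Finset.range ℓ, H ^ i) * M⁻¹) :
    spectrum ℂ (A * C) = (fun μ : ℂ => 1 - μ ^ ℓ) '' spectrum ℂ H := by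
  have hdet : IsUnit M.det := (Matrix.isUnit_iff_isUnit_det M).mp hM
  have hA' : A = M * (1 - H) := by
    rw [hA, hH, mul_sub, mul_one, Matrix.mul_nonsing_inv_cancel_left _ _ hdet]
  obtain ⟨u, rfl⟩ := hM
  have hAC : A * C = u * (1 - H ^ ℓ) * (↑u⁻¹ : Matrix (Fin n) (Fin n) ℂ) := by
    rw [hA', hC, ← mul_neg_geom_sum, Matrix.coe_units_inv]
    simp only [mul_assoc]
  rw [hAC, spectrum.units_conjugate, spectrum.one_sub_pow H hℓ]
end

section
/- Let A, M, N be n × n complex matrices with A = M − N and M invertible, let H = M⁻¹N be semiconvergent, let r₀ be a vector in ℂⁿ, let ℓ and k be positive integers, and let C^{(ℓ)} = (∑_{i=0}^{ℓ−1} H^i) M⁻¹. Then the Krylov subspace K_k(C^{(ℓ)}A, C^{(ℓ)}r₀) is contained in the Krylov subspace K_{kℓ}(C^{(1)}A, C^{(1)}r₀); here C^{(1)} = M⁻¹, so the latter subspace equals K_{kℓ}(M⁻¹A, M⁻¹r₀). -/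
/-- The Krylov subspace of order `k`: `K_k(B, v) = span {v, Bv, …, B^{k-1} v}`. -/
noncomputable def krylov {n : ℕ} (B : Matrix (Fin n) (Fin n) ℂ) (v : Fin n → ℂ) (k : ℕ) :
    Submodule ℂ (Fin n → ℂ) :=
  Submodule.span ℂ {w | ∃ i < k, w = (B ^ i).mulVec v}

open Polynomial in
/-- A polynomial in `B` of degree less than `m` maps `v` into the Krylov subspace of order `m`. -/
theorem aeval_mulVec_mem_krylov {n : ℕ} (B : Matrix (Fin n) (Fin n) ℂ) (v : Fin n → ℂ) {m : ℕ}
    {p : ℂ[X]} (hp : p.natDegree < m) : (aeval B p).mulVec v ∈ krylov B v m := by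
  rw [aeval_eq_sum_range' hp, Matrix.sum_mulVec]
  refine Submodule.sum_mem _ fun i hi => ?_
  rw [Matrix.smul_mulVec]
  exact Submodule.smul_mem _ _ (Submodule.subset_span ⟨i, Finset.mem_range.1 hi, rfl⟩)

open Polynomial in
theorem natDegree_sum_one_sub_X_pow_le (ℓ : ℕ) :
    (∑ i ∈ Finset.range ℓ, (1 - X : ℂ[X]) ^ i).natDegree ≤ ℓ - 1 := by
  refine natDegree_sum_le_of_forall_le _ _ fun i hi => ?_
  have h₁ : (1 - X : ℂ[X]).natDegree ≤ 1 := by compute_degree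
  have h₂ := natDegree_pow_le_of_le i h₁
  have h₃ := Finset.mem_range.1 hi
  omega

/-- If `A = M - N` with `M` invertible and `H = M⁻¹ N` semiconvergent, and
`C⁽ˡ⁾ = (∑_{i=0}^{ℓ-1} H ^ i) M⁻¹`, then
`K_k(C⁽ˡ⁾ A, C⁽ˡ⁾ r₀) ⊆ K_{kℓ}(C⁽¹⁾ A, C⁽¹⁾ r₀) = K_{kℓ}(M⁻¹ A, M⁻¹ r₀)`. -/
theorem krylov_subspace_inclusion {n : ℕ} (A M N H : Matrix (Fin n) (Fin n) ℂ)
    (hM : IsUnit M) (hA : A = M - N) (hH : H = M⁻¹ * N) (hsemi : Semiconvergent H)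
    (r₀ : Fin n → ℂ) (ℓ k : ℕ) (hℓ : 0 < ℓ) (hk : 0 < k)
    (C : Matrix (Fin n) (Fin n) ℂ) (hC : C = (∑ i ∈ Finset.range ℓ, H ^ i) * M⁻¹) :
    krylov (C * A) (C.mulVec r₀) k ≤ krylov (M⁻¹ * A) (M⁻¹.mulVec r₀) (k * ℓ) := by
  have hHB : H = 1 - M⁻¹ * A := by
    rw [hA, hH, mul_sub, Matrix.nonsing_inv_mul M ((Matrix.isUnit_iff_isUnit_det M).1 hM),
      sub_sub_cancel]
  set B := M⁻¹ * A with hB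
  set q : Polynomial ℂ := ∑ i ∈ Finset.range ℓ, (1 - Polynomial.X) ^ i with hq
  have hCq : C = Polynomial.aeval B q * M⁻¹ := by
    simp [hC, hq, hHB]
  have hCA : C * A = Polynomial.aeval B (q * Polynomial.X) := by
    rw [hCq, mul_assoc, ← hB, map_mul, Polynomial.aeval_X]
  have hqdeg : q.natDegree ≤ ℓ - 1 := natDegree_sum_one_sub_X_pow_le ℓ
  refine Submodule.span_le.2 ?_
  rintro _ ⟨i, hi, rfl⟩
  rw [hCA, hCq, ← Matrix.mulVec_mulVec, Matrix.mulVec_mulVec, ← map_pow, ← map_mul]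
  refine aeval_mulVec_mem_krylov B _ ?_
  have hqX : (q * Polynomial.X).natDegree ≤ ℓ :=
    (Polynomial.natDegree_mul_le_of_le hqdeg Polynomial.natDegree_X_le).trans (by omega)
  calc ((q * Polynomial.X) ^ i * q).natDegree
      ≤ i * ℓ + (ℓ - 1) :=
        Polynomial.natDegree_mul_le_of_le (Polynomial.natDegree_pow_le_of_le i hqX) hqdeg
    _ < (i + 1) * ℓ := by rw [add_mul]; omega
    _ ≤ k * ℓ := Nat.mul_le_mul_right ℓ hi
end
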